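/- arXiv:2211.02154 — 3 statements merged into one kernel-verified Lean document; each statement's English description precedes it below -/
import Mathlib

section
/- Let (p_n)_{n≥0} and (q_n)_{n≥1} satisfy p_n, q_n ∈ (0,1) and p_n + q_n = 1 for all n ≥ 1, and assume ∑_{n≥1} ∏_{i=1}^n (p_{i−1}/q_i) < ∞; let ν be the probability vector on ℕ with ν_n proportional to ∏_{i=1}^n (p_{i−1}/q_i) (with the empty product equal to 1). Let Q be the matrix on ℕ with Q(0,1) = p₀, Q(0,0) = −p₀, and, for n ≥ 1, Q(n,n+1) = p_n, Q(n,n−1) = q_n, Q(n,n) = −1, all other entries 0. Let ψ : ℕ → [1,∞) be nondecreasing and bounded, and set Q^ψ(n,m) = ψ(n)·Q(n,m). Since ψ is bounded, μ ↦ μQ^ψ, with (μQ^ψ)(m) = ∑_n μ(n)Q^ψ(n,m), is a bounded linear operator on ℓ¹(ℕ), and one defines ν e^{tQ^ψ} = ∑_{k≥0} (t^k/k!) ν (Q^ψ)^k. Then for every t ≥ 0 and every l ∈ ℕ, ∑_{j=0}^{l} (ν e^{tQ^ψ})(j) ≥ ∑_{j=0}^{l} ν_j; that is, the time-t law ν e^{tQ^ψ}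 of the time-changed birth-and-death process started from its original equilibrium ν is stochastically dominated by ν. -/
open scoped BigOperators

/-- Generator of the birth-and-death process: `Q(0,1) = p 0`, `Q(0,0) = -(p 0)`, and for
`n ≥ 1`, `Q(n,n+1) = p n`, `Q(n,n-1) = q n`, `Q(n,n) = -1`, all other entries `0`. -/
noncomputable def bdGen (p q : ℕ → ℝ) : ℕ → ℕ → ℝ := fun n m =>
  if n = 0 then (if m = 1 then p 0 else if m = 0 then -(p 0) else 0)
  else if m = n + 1 then p n else if m = n - 1 then q n else if m = n then -1 else 0

/-- The time-changed generator `Q^ψ(n,m) = ψ(n) · Q(n,m)`. -/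
noncomputable def bdGenPsi (p q ψ : ℕ → ℝ) : ℕ → ℕ → ℝ := fun n m => ψ n * bdGen p q n m

/-- Right action of `Q^ψ` on a row vector: `(μ Q^ψ)(m) = ∑ n, μ(n) Q^ψ(n,m)`. -/
noncomputable def bdAct (p q ψ : ℕ → ℝ) (μ : ℕ → ℝ) : ℕ → ℝ :=
  fun m => ∑' n : ℕ, μ n * bdGenPsi p q ψ n m

/-- The exponential series `μ e^{t Q^ψ} = ∑_{k≥0} (t^k/k!) μ (Q^ψ)^k`. -/
noncomputable def bdExp (p q ψ : ℕ → ℝ) (t : ℝ) (μ : ℕ → ℝ) : ℕ → ℝ :=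
  fun j => ∑' k : ℕ, t ^ k / (Nat.factorial k) * ((bdAct p q ψ)^[k] μ j)

/-- The unnormalized equilibrium weights `∏_{i=1}^n p_{i-1}/q_i`. -/
noncomputable def bdWeight (p q : ℕ → ℝ) (n : ℕ) : ℝ :=
  ∏ i ∈ Finset.range n, p i / q (i + 1)

open Finset

section ExponentialSeries

variable {V : Type*} [AddCommGroup V] [Module ℝ V]

theorem summable_pow_div_factorial_mul_of_bounded (s : ℝ) {b : ℕ → ℝ} {M : ℝ}
    (hb : ∀ k, |b k| ≤ M) : Summable fun k : ℕ => ‖s ^ k / (k.factorial : ℝ) * b k‖ := by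
  refine Summable.of_nonneg_of_le (fun _ => norm_nonneg _) (fun k => ?_)
    ((Real.summable_pow_div_factorial s).norm.mul_right M)
  rw [norm_mul]
  exact mul_le_mul_of_nonneg_left (hb k) (norm_nonneg _)

/-- Uniformization: `e^{s (B - 1)} = e^{-s} e^{s B}`, tested against a linear functional that is
bounded along the orbit of `B`. -/
theorem hasSum_exp_smul_sub_one (B : Module.End ℝ V) (φ : V →ₗ[ℝ] ℝ) (x : V) (s : ℝ) {M : ℝ}
    (hM : ∀ k, |φ ((B ^ k) x)| ≤ M) :
    HasSum (fun k : ℕ => s ^ k / (k.factorial : ℝ) * φ (((B - 1) ^ k) x))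
      (Real.exp (-s) * ∑' k : ℕ, s ^ k / (k.factorial : ℝ) * φ ((B ^ k) x)) := by
  have hb := summable_pow_div_factorial_mul_of_bounded s hM
  have he : Summable fun k : ℕ => ‖(-s) ^ k / (k.factorial : ℝ)‖ :=
    (Real.summable_pow_div_factorial (-s)).norm
  have hexp : Real.exp (-s) = ∑' k : ℕ, (-s) ^ k / (k.factorial : ℝ) := by
    rw [Real.exp_eq_exp_ℝ, NormedSpace.exp_eq_tsum_div]
  have hterm (k : ℕ) : s ^ k / (k.factorial : ℝ) * φ (((B - 1) ^ k) x) =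
      ∑ ij ∈ antidiagonal k, (s ^ ij.1 / (ij.1.factorial : ℝ) * φ ((B ^ ij.1) x)) *
        ((-s) ^ ij.2 / (ij.2.factorial : ℝ)) := by
    have hc : Commute B (-1 : Module.End ℝ V) := (Commute.one_right B).neg_right
    rw [sub_eq_add_neg, hc.add_pow', LinearMap.sum_apply, map_sum, mul_sum]
    refine sum_congr rfl fun ij hij => ?_
    obtain ⟨i, j⟩ := ij
    obtain rfl : i + j = k := mem_antidiagonal.mp hij
    have hneg : ((-1 : Module.End ℝ V) ^ j) x = (-1 : ℝ) ^ j • x := by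
      rcases Nat.even_or_odd j with h | h <;> simp [h.neg_one_pow]
    have hch : ((i + j).choose i : ℝ) * (i.factorial * j.factorial) = (i + j).factorial := by
      rw [← mul_assoc]
      rw [Nat.choose_symm_add]
      exact_mod_cast Nat.add_choose_mul_factorial_mul_factorial i j
    have hi : (i.factorial : ℝ) ≠ 0 := by positivity
    have hj : (j.factorial : ℝ) ≠ 0 := by positivity
    have hk : ((i + j).factorial : ℝ) ≠ 0 := by positivity
    simp only [LinearMap.smul_apply, Module.End.mul_apply, hneg, map_smul, map_nsmul]
    simp only [nsmul_eq_mul, smul_eq_mul]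
    rw [neg_pow s j, ← hch]
    have hc0 : ((i + j).choose i : ℝ) ≠ 0 := fun h => hk (by rw [← hch, h, zero_mul])
    field_simp
    ring
  rw [hexp, mul_comm,
    tsum_mul_tsum_eq_tsum_sum_antidiagonal_of_summable_norm hb he]
  simp_rw [hterm]
  exact (summable_norm_sum_mul_antidiagonal_of_summable_norm hb he).of_norm.hasSum

end ExponentialSeries

section ForwardOperator

variable (p q ψ μ : ℕ → ℝ)

theorem bdAct_zero : bdAct p q ψ μ 0 = μ 1 * ψ 1 * q 1 - μ 0 * ψ 0 * p 0 := by
  rw [bdAct, tsum_eq_sum (s := {0, 1})]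
  · simp [bdGenPsi, bdGen]
    ring
  · intro n hn
    simp only [mem_insert, mem_singleton, not_or] at hn
    have h : (0 : ℕ) ≠ n - 1 := by omega
    simp [bdGenPsi, bdGen, hn.1, Ne.symm hn.1, h]

theorem bdAct_succ (m : ℕ) : bdAct p q ψ μ (m + 1) =
    μ m * ψ m * p m - μ (m + 1) * ψ (m + 1) + μ (m + 2) * ψ (m + 2) * q (m + 2) := by
  rw [bdAct, tsum_eq_sum (s := {m, m + 1, m + 2})]
  · rw [sum_insert (by simp), sum_insert (by simp), sum_singleton]
    have h : bdGen p q m (m + 1) = p m := by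
      rcases m with _ | m <;> simp [bdGen]
    simp only [bdGenPsi, h]
    simp [bdGen]
    ring
  · intro n hn
    simp only [mem_insert, mem_singleton, not_or] at hn
    rcases n with _ | n
    · have h : m ≠ 0 := by omega
      simp [bdGenPsi, bdGen, h]
    · have h2 : m + 1 ≠ n := by omega
      have h3 : m ≠ n := by omega
      simp [bdGenPsi, bdGen, h2, h3]
      omega

/-- `bdAct` as a linear endomorphism of all row vectors. -/
noncomputable def bdActLin : Module.End ℝ (ℕ → ℝ) where
  toFun := bdAct p q ψ
  map_add' μ₁ μ₂ := by
    ext m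
    rcases m with _ | m <;> simp only [Pi.add_apply, bdAct_zero, bdAct_succ] <;> ring
  map_smul' c μ := by
    ext m
    rcases m with _ | m <;>
      simp only [Pi.smul_apply, smul_eq_mul, RingHom.id_apply, bdAct_zero, bdAct_succ] <;> ring

theorem bdActLin_apply : bdActLin p q ψ μ = bdAct p q ψ μ := rfl

theorem bdAct_iterate (k : ℕ) : (bdAct p q ψ)^[k] μ = (bdActLin p q ψ ^ k) μ := by
  rw [Module.End.pow_apply]
  rfl

variable {p q ψ μ}

theorem sum_range_succ_bdAct (hpq : ∀ n, 1 ≤ n → p n + q n = 1) (l : ℕ) :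
    ∑ j ∈ range (l + 1), bdAct p q ψ μ j =
      μ (l + 1) * ψ (l + 1) * q (l + 1) - μ l * ψ l * p l := by
  induction l with
  | zero => simp [bdAct_zero]
  | succ l ih =>
    rw [sum_range_succ, ih, bdAct_succ]
    linear_combination (μ (l + 1) * ψ (l + 1)) * hpq (l + 1) (by omega)

end ForwardOperator

/-- The backward transition operator `1 + K⁻¹ Q^ψ` of the uniformized chain, acting on
functions. The truncated subtraction makes the death term vanish at `0`. -/
noncomputable def bdBackward (p q ψ : ℕ → ℝ) (K : ℝ) (f : ℕ → ℝ) : ℕ → ℝ := fun n =>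
  f n + ψ n / K * (p n * (f (n + 1) - f n) - q n * (f n - f (n - 1)))

section BackwardOperator

variable {p q ψ f : ℕ → ℝ} {K : ℝ}

theorem bdBackward_mem_Icc (hp : ∀ n, 0 ≤ p n) (hq : ∀ n, 1 ≤ n → 0 ≤ q n)
    (hp1 : ∀ n, p n ≤ 1) (hpq : ∀ n, 1 ≤ n → p n + q n = 1) (hψ : ∀ n, 0 ≤ ψ n / K)
    (hψK : ∀ n, ψ n / K ≤ 1) {M : ℝ} (hf : ∀ n, f n ∈ Set.Icc 0 M) (n : ℕ) :
    bdBackward p q ψ K f n ∈ Set.Icc 0 M := by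
  have key : ∃ a b c : ℝ, 0 ≤ a ∧ 0 ≤ b ∧ 0 ≤ c ∧ a + b + c = 1 ∧
      bdBackward p q ψ K f n = a * f n + b * f (n + 1) + c * f (n - 1) := by
    rcases n with _ | n
    · refine ⟨1 - ψ 0 / K * p 0, ψ 0 / K * p 0, 0, ?_, mul_nonneg (hψ 0) (hp 0), le_rfl,
        by ring, by simp [bdBackward]; ring⟩
      linarith [mul_le_one₀ (hψK 0) (hp 0) (hp1 0)]
    · refine ⟨1 - ψ (n + 1) / K, ψ (n + 1) / K * p (n + 1), ψ (n + 1) / K * q (n + 1),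
        sub_nonneg.2 (hψK _), mul_nonneg (hψ _) (hp _), mul_nonneg (hψ _) (hq _ (by omega)),
        ?_, ?_⟩
      · linear_combination ψ (n + 1) / K * hpq (n + 1) (by omega)
      · rw [bdBackward]
        linear_combination (-(ψ (n + 1) / K) * f (n + 1)) * hpq (n + 1) (by omega)
  obtain ⟨a, b, c, ha, hb, hc, habc, h⟩ := key
  rw [h]
  constructor
  · have := (hf n).1
    have := (hf (n + 1)).1
    have := (hf (n - 1)).1
    positivity
  · have h1 := mul_le_mul_of_nonneg_left (hf n).2 ha
    have h2 := mul_le_mul_of_nonneg_left (hf (n + 1)).2 hb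
    have h3 := mul_le_mul_of_nonneg_left (hf (n - 1)).2 hc
    have : a * M + b * M + c * M = M := by rw [← add_mul, ← add_mul, habc, one_mul]
    linarith

theorem bdBackward_monotone (hp : ∀ n, 0 ≤ p n) (hq : ∀ n, 1 ≤ n → 0 ≤ q n)
    (hp1 : ∀ n, p n ≤ 1) (hq1 : ∀ n, 1 ≤ n → q n ≤ 1) (hψ : ∀ n, 0 ≤ ψ n / K)
    (hψK : ∀ n, ψ n / K ≤ 1 / 2) (hf : Monotone f) : Monotone (bdBackward p q ψ K f) := by
  refine monotone_nat_of_le_succ fun n => ?_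
  simp only [bdBackward, Nat.add_sub_cancel]
  have hd : 0 ≤ f (n + 1) - f n := sub_nonneg.2 (hf n.le_succ)
  have h1 : 0 ≤ ψ (n + 1) / K * (p (n + 1) * (f (n + 1 + 1) - f (n + 1))) :=
    mul_nonneg (hψ _) (mul_nonneg (hp _) (sub_nonneg.2 (hf (n + 1).le_succ)))
  have h2 : 0 ≤ ψ n / K * (q n * (f n - f (n - 1))) := by
    rcases n with _ | n
    · simp
    · exact mul_nonneg (hψ _) (mul_nonneg (hq _ (by omega)) (sub_nonneg.2 (hf (by omega))))
  have h3 : ψ (n + 1) / K * q (n + 1) ≤ 1 / 2 :=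
    (mul_le_of_le_one_right (hψ _) (hq1 _ (by omega))).trans (hψK _)
  have h4 : ψ n / K * p n ≤ 1 / 2 :=
    (mul_le_of_le_one_right (hψ _) (hp1 _)).trans (hψK _)
  have h5 := mul_le_mul_of_nonneg_right (add_le_add h3 h4) hd
  linarith

end BackwardOperator

/-- Reversibility turns the forward step on `ν g / ψ` into the backward step on `g`. -/
theorem one_add_bdActLin_mul_eq {p q ψ ν μ g : ℕ → ℝ} {K : ℝ} (hpq : ∀ n, 1 ≤ n → p n + q n = 1)
    (hrev : ∀ n, ν n * p n = ν (n + 1) * q (n + 1)) (hμ : ∀ n, μ n * ψ n = ν n * g n) (n : ℕ) :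
    (1 + K⁻¹ • bdActLin p q ψ) μ n * ψ n = ν n * bdBackward p q ψ K g n := by
  have h : bdAct p q ψ μ n =
      ν n * (p n * (g (n + 1) - g n) - q n * (g n - g (n - 1))) := by
    rcases n with _ | n
    · rw [bdAct_zero, hμ, hμ]
      simp
      linear_combination (-g 1) * hrev 0
    · rw [bdAct_succ, hμ, hμ, hμ]
      simp only [Nat.add_sub_cancel]
      linear_combination (-g (n + 2)) * hrev (n + 1) + g n * hrev n +
        ν (n + 1) * g (n + 1) * hpq (n + 1) (by omega)
  simp only [LinearMap.add_apply, Module.End.one_apply, LinearMap.smul_apply, Pi.add_apply,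
    Pi.smul_apply, smul_eq_mul, bdActLin_apply, h, bdBackward, mul_add, add_mul, hμ]
  ring

theorem bdWeight_nonneg {p q : ℕ → ℝ} (hp : ∀ n, 0 ≤ p n) (hq : ∀ n, 1 ≤ n → 0 ≤ q n) (n : ℕ) :
    0 ≤ bdWeight p q n :=
  prod_nonneg fun i _ => div_nonneg (hp i) (hq (i + 1) (by omega))

theorem bdWeight_mul_eq {p q : ℕ → ℝ} (hq : ∀ n, 1 ≤ n → q n ≠ 0) (n : ℕ) :
    bdWeight p q n * p n = bdWeight p q (n + 1) * q (n + 1) := by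
  have := hq (n + 1) (by omega)
  rw [bdWeight, bdWeight, prod_range_succ]
  field_simp

/-- **Stochastic domination of the time-changed birth-and-death process started from
equilibrium** (Lemma 3.4): `ν e^{t Q^ψ} ⪯ ν` for every `t ≥ 0`, when `ψ : ℕ → [1,∞)` is
nondecreasing and bounded and `ν` is the (normalized) equilibrium distribution of the
ergodic birth-and-death chain with rates `p, q`. -/
theorem bd_equilibrium_dominates_timeChanged (p q ψ : ℕ → ℝ)
    (hp : ∀ n, p n ∈ Set.Ioo (0 : ℝ) 1)
    (hq : ∀ n, 1 ≤ n → q n ∈ Set.Ioo (0 : ℝ) 1)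
    (hpq : ∀ n, 1 ≤ n → p n + q n = 1)
    (hsum : Summable (bdWeight p q))
    (ν : ℕ → ℝ) (hν : ∀ n, ν n = bdWeight p q n / ∑' m : ℕ, bdWeight p q m)
    (hψ1 : ∀ n, 1 ≤ ψ n) (hψmono : Monotone ψ) (hψbdd : ∃ C : ℝ, ∀ n, ψ n ≤ C) :
    ∀ t : ℝ, 0 ≤ t → ∀ l : ℕ,
      ∑ j ∈ Finset.range (l + 1), ν j ≤ ∑ j ∈ Finset.range (l + 1), bdExp p q ψ t ν j := by
  intro t ht l
  obtain ⟨C, hC⟩ := hψbdd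
  have hp0 n : 0 ≤ p n := (hp n).1.le
  have hp1 n : p n ≤ 1 := (hp n).2.le
  have hq0 n (hn : 1 ≤ n) : 0 ≤ q n := (hq n hn).1.le
  have hq1 n (hn : 1 ≤ n) : q n ≤ 1 := (hq n hn).2.le
  have hψ0 n : 0 < ψ n := one_pos.trans_le (hψ1 n)
  have hC0 : 0 < C := (hψ0 0).trans_le (hC 0)
  set K : ℝ := 2 * C with hK
  have hK0 : 0 < K := by positivity
  have hψK n : 0 ≤ ψ n / K := div_nonneg (hψ0 n).le hK0.le
  have hψK2 n : ψ n / K ≤ 1 / 2 := by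
    rw [div_le_iff₀ hK0]
    linarith [hC n]
  have hν0 n : 0 ≤ ν n := by
    rw [hν]
    exact div_nonneg (bdWeight_nonneg hp0 hq0 n) (tsum_nonneg (bdWeight_nonneg hp0 hq0))
  have hrev n : ν n * p n = ν (n + 1) * q (n + 1) := by
    rw [hν, hν, div_mul_eq_mul_div, div_mul_eq_mul_div,
      bdWeight_mul_eq fun n hn => (hq n hn).1.ne']
  set B : Module.End ℝ (ℕ → ℝ) := 1 + K⁻¹ • bdActLin p q ψ with hB
  set g : ℕ → ℕ → ℝ := fun k => (bdBackward p q ψ K)^[k] ψ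
  have hg_succ k : g (k + 1) = bdBackward p q ψ K (g k) := Function.iterate_succ_apply' _ _ _
  have hg_mono k : Monotone (g k) := by
    induction k with
    | zero => exact hψmono
    | succ k ih => exact hg_succ k ▸ bdBackward_monotone hp0 hq0 hp1 hq1 hψK hψK2 ih
  have hg_mem k : ∀ n, g k n ∈ Set.Icc 0 C := by
    induction k with
    | zero => exact fun n => ⟨(hψ0 n).le, hC n⟩
    | succ k ih =>
      exact hg_succ k ▸ bdBackward_mem_Icc hp0 hq0 hp1 hpq hψK
        (fun n => (hψK2 n).trans (by norm_num)) ih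
  have hBg k : ∀ n, (B ^ k) ν n * ψ n = ν n * g k n := by
    induction k with
    | zero => exact fun n => rfl
    | succ k ih =>
      intro n
      rw [pow_succ', Module.End.mul_apply, hg_succ]
      exact one_add_bdActLin_mul_eq hpq hrev ih n
  have hB_bdd j k : |(B ^ k) ν j| ≤ ν j * C := by
    have h0 : 0 ≤ (B ^ k) ν j * ψ j := hBg k j ▸ mul_nonneg (hν0 j) (hg_mem k j).1
    have h1 : 0 ≤ (B ^ k) ν j := nonneg_of_mul_nonneg_left h0 (hψ0 j)
    rw [abs_of_nonneg h1]
    calc (B ^ k) ν j ≤ (B ^ k) ν j * ψ j := le_mul_of_one_le_right h1 (hψ1 j)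
      _ = ν j * g k j := hBg k j
      _ ≤ ν j * C := mul_le_mul_of_nonneg_left (hg_mem k j).2 (hν0 j)
  have hmass : Monotone fun k => ∑ j ∈ range (l + 1), (B ^ k) ν j := by
    refine monotone_nat_of_le_succ fun k => ?_
    simp only [pow_succ' B, Module.End.mul_apply]
    nth_rw 2 [hB]
    simp only [LinearMap.add_apply, Module.End.one_apply,
      LinearMap.smul_apply, Pi.add_apply, Pi.smul_apply, smul_eq_mul, sum_add_distrib, ← mul_sum,
      bdActLin_apply, sum_range_succ_bdAct hpq, hBg]
    refine le_add_of_nonneg_right (mul_nonneg (inv_nonneg.2 hK0.le) ?_)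
    have := mul_nonneg (mul_nonneg (hν0 l) (hp0 l)) (sub_nonneg.2 (hg_mono k l.le_succ))
    linear_combination this + g k (l + 1) * hrev l
  have hA : bdActLin p q ψ = K • (B - 1) := by
    rw [hB, add_sub_cancel_left, smul_smul, mul_inv_cancel₀ hK0.ne', one_smul]
  set s : ℝ := t * K with hs
  have hs0 : 0 ≤ s := by positivity
  have hexp j : bdExp p q ψ t ν j =
      Real.exp (-s) * ∑' k : ℕ, s ^ k / (k.factorial : ℝ) * (B ^ k) ν j := by
    refine Eq.trans ?_ (hasSum_exp_smul_sub_one B (LinearMap.proj j) ν s (hB_bdd j)).tsum_eq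
    refine tsum_congr fun k => ?_
    rw [bdAct_iterate, hA, smul_pow]
    simp only [LinearMap.smul_apply, Pi.smul_apply, smul_eq_mul, LinearMap.proj_apply, hs, mul_pow]
    ring
  have hsummable j : Summable fun k : ℕ => s ^ k / (k.factorial : ℝ) * (B ^ k) ν j :=
    (summable_pow_div_factorial_mul_of_bounded s (hB_bdd j)).of_norm
  simp_rw [hexp]
  rw [← mul_sum, ← Summable.tsum_finsetSum fun j _ => hsummable j]
  simp_rw [← mul_sum]
  calc ∑ j ∈ range (l + 1), ν j
      = Real.exp (-s) * ∑' k : ℕ, s ^ k / (k.factorial : ℝ) * ∑ j ∈ range (l + 1), ν j := by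
        rw [tsum_mul_right, ← congrFun NormedSpace.exp_eq_tsum_div s, ← Real.exp_eq_exp_ℝ,
          ← mul_assoc, ← Real.exp_add, neg_add_cancel, Real.exp_zero, one_mul]
    _ ≤ _ := by
        refine mul_le_mul_of_nonneg_left (Summable.tsum_le_tsum (fun k => ?_)
          ((Real.summable_pow_div_factorial s).mul_right _) ?_) (Real.exp_pos _).le
        · exact mul_le_mul_of_nonneg_left (hmass k.zero_le) (by positivity)
        · simp_rw [mul_sum]
          exact summable_sum fun j _ => hsummable j
end

section
/- Consider sequences (p_n)_{n≥0}, (q_n)_{n≥1} with p_n, q_n ∈ (0,1), p_n + q_n = 1 for all n ≥ 1, p_n ≤ q_n for all n ≥ 1, and inf_n p_n > 0; set ρ_n = p_n/q_n, R₀ = 1, R_n = ∏_{i=1}^n ρ_i, S_n = ∑_{i≥n} R_i, and assume ∑_{n≥1} ∏_{i=1}^n (p_{i−1}/q_i) < ∞, with ν the probability measure on ℕ having ν_n proportional to ∏_{i=1}^n (p_{i−1}/q_i). Let (w_k)_{k≥0} be the discrete-time birth-and-death Markov chain on ℕ with transition probabilities P(n,n+1) = p_n and P(n,n−1) = q_n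 for n ≥ 1 and P(0,1) = 1, and let T₀ = inf{k ≥ 0 : w_k = 0}. Then the following are equivalent: (i) ∑_{n≥1} S_n²/R_n < ∞; (ii) 𝔼_ν[T₀] < ∞, the expectation when the chain starts with initial distribution ν; (iii) 𝔼₁[T₀²] < ∞, the second moment when the chain starts from 1. -/
open MeasureTheory
open scoped ENNReal BigOperators

/-- Transition matrix of the embedded discrete birth-and-death chain:
`P(0,1) = 1`, and for `n ≥ 1`, `P(n,n+1) = p n`, `P(n,n-1) = q n`, other entries `0`. -/
noncomputable def bdStep (p q : ℕ → ℝ) : ℕ → ℕ → ℝ := fun n m =>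
  if n = 0 then (if m = 1 then 1 else 0)
  else if m = n + 1 then p n else if m = n - 1 then q n else 0

/-- `μ` is the law on path space of the discrete-time Markov chain with initial
distribution `init` and transition matrix `P`: cylinder probabilities are given by
`init(a₀) ∏_{i<n} P(aᵢ, aᵢ₊₁)`. -/
def IsMarkovChainLaw (μ : Measure (ℕ → ℕ)) (init : ℕ → ℝ) (P : ℕ → ℕ → ℝ) : Prop :=
  ∀ (n : ℕ) (a : ℕ → ℕ),
    μ {w | ∀ i ≤ n, w i = a i}
      = ENNReal.ofReal (init (a 0) * ∏ i ∈ Finset.range n, P (a i) (a (i + 1)))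

/-- The hitting time `inf {k ≥ 0 : w k = m}` of state `m`, valued in `[0,∞]`
(`= ∞` if the path never visits `m`). -/
noncomputable def hitTimeE (m : ℕ) (w : ℕ → ℕ) : ℝ≥0∞ :=
  ⨅ (k : ℕ) (_ : w k = m), (k : ℝ≥0∞)

/-- `R n = ∏_{i=1}^n p_i/q_i` (with `R 0 = 1`). -/
noncomputable def bdR (p q : ℕ → ℝ) (n : ℕ) : ℝ := ∏ i ∈ Finset.Icc 1 n, p i / q i

/-- `S n = ∑_{i ≥ n} R i`. -/
noncomputable def bdS (p q : ℕ → ℝ) (n : ℕ) : ℝ := ∑' j : ℕ, bdR p q (n + j)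

open Filter Topology

section HittingTime

/-- Paths that avoid the state `m` up to and including time `k`. -/
def avoidUpTo (m k : ℕ) : Set (ℕ → ℕ) := {w | ∀ i ≤ k, w i ≠ m}

lemma measurableSet_avoidUpTo (m k : ℕ) : MeasurableSet (avoidUpTo m k) := by
  have : avoidUpTo m k = ⋂ i ∈ Set.Iic k, (fun w : ℕ → ℕ => w i) ⁻¹' {m}ᶜ := by
    ext w; simp [avoidUpTo]
  rw [this]
  exact MeasurableSet.biInter (Set.to_countable _)
    fun i _ => measurable_pi_apply i (MeasurableSet.of_discrete)

/-- A nonnegative additive functional of the hitting time as a sum over survival indicators. -/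
lemma tsum_indicator_avoidUpTo (m : ℕ) (g : ℕ → ℝ≥0∞) (hg : ∀ k, 1 ≤ g k) (G : ℝ≥0∞ → ℝ≥0∞)
    (hG : ∀ N : ℕ, G N = ∑ k ∈ Finset.range N, g k) (htop : G ⊤ = ⊤) (w : ℕ → ℕ) :
    G (hitTimeE m w) = ∑' k, (avoidUpTo m k).indicator (fun _ => g k) w := by
  classical
  by_cases h : ∃ k, w k = m
  · have hval : hitTimeE m w = (Nat.find h : ℝ≥0∞) := by
      apply le_antisymm
      · exact iInf₂_le (Nat.find h) (Nat.find_spec h)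
      · refine le_iInf₂ fun k hk => ?_
        exact_mod_cast Nat.find_min' h hk
    have hmem : ∀ k, w ∈ avoidUpTo m k ↔ k < Nat.find h := fun k => by
      rw [Nat.lt_find_iff]; rfl
    rw [hval, hG, tsum_eq_sum (s := Finset.range (Nat.find h))]
    · refine Finset.sum_congr rfl fun k hk => ?_
      rw [Set.indicator_of_mem ((hmem k).2 (Finset.mem_range.1 hk))]
    · intro k hk
      rw [Set.indicator_of_notMem]
      rwa [hmem, ← Finset.mem_range]
  · push Not at h
    have hval : hitTimeE m w = ⊤ := by simp [hitTimeE, h]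
    rw [hval, htop, eq_comm, eq_top_iff, ← ENNReal.tsum_const_eq_top_of_ne_zero (α := ℕ) one_ne_zero]
    refine ENNReal.tsum_le_tsum fun k => ?_
    rw [Set.indicator_of_mem (show w ∈ avoidUpTo m k from fun i _ => h i)]
    exact hg k

lemma lintegral_comp_hitTimeE (μ : Measure (ℕ → ℕ)) (m : ℕ) (g : ℕ → ℝ≥0∞) (hg : ∀ k, 1 ≤ g k)
    (G : ℝ≥0∞ → ℝ≥0∞) (hG : ∀ N : ℕ, G N = ∑ k ∈ Finset.range N, g k) (htop : G ⊤ = ⊤) :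
    ∫⁻ w, G (hitTimeE m w) ∂μ = ∑' k, g k * μ (avoidUpTo m k) := by
  simp_rw [tsum_indicator_avoidUpTo m g hg G hG htop]
  rw [lintegral_tsum fun k =>
    (measurable_const.indicator (measurableSet_avoidUpTo m k)).aemeasurable]
  exact tsum_congr fun k => lintegral_indicator_const (measurableSet_avoidUpTo m k) _

lemma lintegral_hitTimeE (μ : Measure (ℕ → ℕ)) (m : ℕ) :
    ∫⁻ w, hitTimeE m w ∂μ = ∑' k, μ (avoidUpTo m k) := by
  simpa using lintegral_comp_hitTimeE μ m (fun _ => 1) (fun _ => le_rfl) id (by simp) rfl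

lemma lintegral_hitTimeE_sq (μ : Measure (ℕ → ℕ)) (m : ℕ) :
    ∫⁻ w, hitTimeE m w ^ 2 ∂μ = ∑' k : ℕ, (2 * k + 1 : ℝ≥0∞) * μ (avoidUpTo m k) := by
  refine lintegral_comp_hitTimeE μ m _ (fun k => le_add_self) (· ^ 2) (fun N => ?_) (by simp)
  induction N with
  | zero => simp
  | succ N ih =>
    rw [Finset.sum_range_succ, ← ih]
    push_cast
    ring

end HittingTime

section TailSums

lemma ENNReal.tsum_add_left_eq (g : ℕ → ℝ≥0∞) (k : ℕ) :
    ∑' j, g (k + j) = ∑' n, if k ≤ n then g n else 0 := by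
  rw [← Summable.sum_add_tsum_nat_add' (f := fun n => if k ≤ n then g n else 0) (k := k)
      ENNReal.summable,
    Finset.sum_eq_zero, zero_add]
  · exact tsum_congr fun j => by simp [add_comm]
  · intro i hi
    simp [Finset.mem_range.1 hi]

lemma ENNReal.tsum_mul_sum_range_succ (a b : ℕ → ℝ≥0∞) :
    ∑' n, a n * ∑ i ∈ Finset.range (n + 1), b i = ∑' i, b i * ∑' j, a (i + j) := by
  have h : ∀ n, a n * ∑ i ∈ Finset.range (n + 1), b i
      = ∑' i, b i * if i ≤ n then a n else 0 := fun n => by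
    rw [tsum_eq_sum (s := Finset.range (n + 1)), Finset.mul_sum]
    · refine Finset.sum_congr rfl fun i hi => ?_
      rw [if_pos (Nat.lt_succ_iff.1 (Finset.mem_range.1 hi)), mul_comm]
    · intro i hi
      rw [if_neg (fun h => hi (Finset.mem_range.2 (Nat.lt_succ_of_le h))), mul_zero]
  simp_rw [h, ENNReal.tsum_add_left_eq]
  rw [ENNReal.tsum_comm]
  simp_rw [ENNReal.tsum_mul_left]

lemma ENNReal.tsum_tsum_add (g : ℕ → ℝ≥0∞) :
    ∑' k, ∑' j, g (k + j) = ∑' n : ℕ, (n + 1 : ℝ≥0∞) * g n := by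
  have := ENNReal.tsum_mul_sum_range_succ g fun _ => 1
  simpa [mul_comm] using this.symm

/-- Telescoping a summable sequence of increments. -/
lemma tsum_eq_of_telescope {a g : ℕ → ℝ} (ha : Summable a) (h : ∀ n, a n = g n - g (n + 1))
    (hg : Tendsto g atTop (𝓝 0)) : ∑' n, a n = g 0 := by
  refine tendsto_nhds_unique ha.hasSum.tendsto_sum_nat ?_
  simp_rw [h, Finset.sum_range_sub']
  simpa using tendsto_const_nhds.sub hg

end TailSums

/-- Standing assumptions on the parameters of a birth-and-death chain. -/
structure IsBDParams (p q : ℕ → ℝ) : Prop where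
  p_pos : ∀ n, 0 < p n
  q_pos : ∀ n, 0 < q (n + 1)
  add_eq : ∀ n, p (n + 1) + q (n + 1) = 1
  le : ∀ n, p (n + 1) ≤ q (n + 1)

/-- Probability that the chain started at `x` avoids `0` up to and including time `k`. -/
noncomputable def bdSurv (p q : ℕ → ℝ) : ℕ → ℕ → ℝ
  | _, 0 => 0
  | 0, _ + 1 => 1
  | k + 1, x + 1 => p (x + 1) * bdSurv p q k (x + 2) + q (x + 1) * bdSurv p q k x

/-- Reversible measure of the state `n + 1`. -/
noncomputable def bdRev (p q : ℕ → ℝ) (n : ℕ) : ℝ := bdR p q (n + 1) / p (n + 1)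

/-- Mass of survivors at time `k` in states `> j`, started from the reversible measure. -/
noncomputable def bdTail (p q : ℕ → ℝ) (k j : ℕ) : ℝ :=
  ∑' i, bdRev p q (j + i) * bdSurv p q k (j + i + 1)

section Survival

variable {p q : ℕ → ℝ}

@[simp] lemma bdSurv_zero_right (k : ℕ) : bdSurv p q k 0 = 0 := by cases k <;> rfl

@[simp] lemma bdSurv_zero_succ (x : ℕ) : bdSurv p q 0 (x + 1) = 1 := rfl

lemma bdSurv_succ_succ (k x : ℕ) :
    bdSurv p q (k + 1) (x + 1) = p (x + 1) * bdSurv p q k (x + 2) + q (x + 1) * bdSurv p q k x :=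
  rfl

namespace IsBDParams

lemma surv_nonneg (h : IsBDParams p q) (k x : ℕ) : 0 ≤ bdSurv p q k x := by
  induction k generalizing x with
  | zero => cases x <;> simp
  | succ k ih =>
    cases x with
    | zero => simp
    | succ x =>
      have := mul_nonneg (h.p_pos (x + 1)).le (ih (x + 2))
      have := mul_nonneg (h.q_pos x).le (ih x)
      rw [bdSurv_succ_succ]; linarith

lemma surv_le_one (h : IsBDParams p q) (k x : ℕ) : bdSurv p q k x ≤ 1 := by
  induction k generalizing x with
  | zero => cases x <;> simp
  | succ k ih =>
    cases x with
    | zero => simp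
    | succ x =>
      have := mul_le_mul_of_nonneg_left (ih (x + 2)) (h.p_pos (x + 1)).le
      have := mul_le_mul_of_nonneg_left (ih x) (h.q_pos x).le
      rw [bdSurv_succ_succ]; linarith [h.add_eq x]

lemma surv_succ_le (h : IsBDParams p q) (k x : ℕ) : bdSurv p q (k + 1) x ≤ bdSurv p q k x := by
  induction k generalizing x with
  | zero =>
    cases x with
    | zero => simp
    | succ x => exact h.surv_le_one _ _
  | succ k ih =>
    cases x with
    | zero => simp
    | succ x =>
      have := mul_le_mul_of_nonneg_left (ih (x + 2)) (h.p_pos (x + 1)).le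
      have := mul_le_mul_of_nonneg_left (ih x) (h.q_pos x).le
      rw [bdSurv_succ_succ (k + 1), bdSurv_succ_succ k x]; linarith

/-- Recurrence: the chain reaches `0` almost surely. -/
lemma tendsto_surv (h : IsBDParams p q) (x : ℕ) :
    Tendsto (fun k => bdSurv p q k x) atTop (𝓝 0) := by
  have hlim : ∀ x, ∃ L, Tendsto (fun k => bdSurv p q k x) atTop (𝓝 L) := fun x =>
    ⟨_, tendsto_atTop_ciInf (antitone_nat_of_succ_le fun k => h.surv_succ_le k x)
      ⟨0, by rintro _ ⟨k, rfl⟩; exact h.surv_nonneg k x⟩⟩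
  choose L hL using hlim
  have hL0 : L 0 = 0 := tendsto_nhds_unique (hL 0) (by simp)
  have hnn : ∀ x, 0 ≤ L x := fun x => ge_of_tendsto' (hL x) fun k => h.surv_nonneg k x
  have hle : ∀ x, L x ≤ 1 := fun x => le_of_tendsto' (hL x) fun k => h.surv_le_one k x
  have hrec : ∀ x, L (x + 1) = p (x + 1) * L (x + 2) + q (x + 1) * L x := fun x =>
    tendsto_nhds_unique ((hL (x + 1)).comp (tendsto_add_atTop_nat 1))
      (((hL (x + 2)).const_mul _).add ((hL x).const_mul _))
  have hdiff : ∀ x, p (x + 1) * (L (x + 2) - L (x + 1)) = q (x + 1) * (L (x + 1) - L x) :=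
    fun x => by linear_combination L (x + 1) * -h.add_eq x - hrec x
  have hincr : ∀ x, L 1 ≤ L (x + 1) - L x := by
    intro x
    induction x with
    | zero => simp [hL0]
    | succ x ih =>
      have h0 : 0 ≤ L (x + 1) - L x := (hnn 1).trans ih
      have h1 := mul_le_mul_of_nonneg_right (h.le x) h0
      rw [← hdiff x] at h1
      exact ih.trans (le_of_mul_le_mul_left h1 (h.p_pos _))
  have hlin : ∀ x : ℕ, x * L 1 ≤ L x := by
    intro x
    induction x with
    | zero => simp [hL0]
    | succ x ih => push_cast; linarith [hincr x]
  have hL1 : L 1 = 0 := by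
    by_contra hne
    have hpos : 0 < L 1 := lt_of_le_of_ne (hnn 1) (Ne.symm hne)
    obtain ⟨n, hn⟩ := exists_nat_gt (1 / L 1)
    rw [div_lt_iff₀ hpos] at hn
    linarith [hlin n, hle n]
  have hconst : ∀ x, L (x + 1) - L x = 0 := by
    intro x
    induction x with
    | zero => simp [hL0, hL1]
    | succ x ih =>
      have := hdiff x
      rw [ih, mul_zero] at this
      exact (mul_eq_zero.1 this).resolve_left (h.p_pos _).ne'
  have hzero : L x = 0 := by
    induction x with
    | zero => exact hL0
    | succ x ih => linarith [hconst x]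
  exact hzero ▸ hL x

end IsBDParams

end Survival

section PathLaw

variable {p q : ℕ → ℝ}

lemma bdStep_nonneg (h : IsBDParams p q) (n m : ℕ) : 0 ≤ bdStep p q n m := by
  rcases n with _ | n
  · by_cases hm : m = 1 <;> simp [bdStep, hm]
  · have := (h.p_pos (n + 1)).le
    have := (h.q_pos n).le
    unfold bdStep
    split_ifs <;> first | assumption | simp

lemma tsum_bdStep_mul_bdSurv (h : IsBDParams p q) (k x : ℕ) :
    ∑' b, ENNReal.ofReal (bdStep p q (x + 1) b) * ENNReal.ofReal (bdSurv p q k b)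
      = ENNReal.ofReal (bdSurv p q (k + 1) (x + 1)) := by
  rw [tsum_eq_sum (s := {x + 2, x}), Finset.sum_pair (by omega), bdSurv_succ_succ,
    ENNReal.ofReal_add (mul_nonneg (h.p_pos _).le (h.surv_nonneg _ _))
      (mul_nonneg (h.q_pos _).le (h.surv_nonneg _ _)),
    ENNReal.ofReal_mul (h.p_pos _).le, ENNReal.ofReal_mul (h.q_pos _).le]
  · simp [bdStep, show x ≠ x + 1 + 1 by omega]
  · intro b hb
    simp only [Finset.mem_insert, Finset.mem_singleton, not_or] at hb
    simp [bdStep, hb.1, hb.2]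

lemma measure_cylinder_inter_avoid (h : IsBDParams p q) {μ : Measure (ℕ → ℕ)} {init : ℕ → ℝ}
    (hinit : ∀ x, 0 ≤ init x) (hμ : IsMarkovChainLaw μ init (bdStep p q)) (k n : ℕ) (a : ℕ → ℕ) :
    μ {w | (∀ i ≤ n, w i = a i) ∧ ∀ i ≤ k, w (n + i) ≠ 0}
      = ENNReal.ofReal (init (a 0) * ∏ i ∈ Finset.range n, bdStep p q (a i) (a (i + 1)))
        * ENNReal.ofReal (bdSurv p q k (a n)) := by
  induction k generalizing n a with
  | zero =>
    rcases hx : a n with _ | x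
    · rw [bdSurv_zero_right, ENNReal.ofReal_zero, mul_zero]
      convert measure_empty (μ := μ)
      ext w
      simp only [Set.mem_ofPred_eq, Set.mem_empty_iff_false, iff_false, not_and]
      intro hw hne
      exact hne 0 le_rfl ((hw n le_rfl).trans hx)
    · rw [bdSurv_zero_succ, ENNReal.ofReal_one, mul_one, ← hμ n a]
      congr 1
      ext w
      simp only [Set.mem_ofPred_eq, and_iff_left_iff_imp]
      intro hw i hi
      obtain rfl : i = 0 := by omega
      rw [add_zero, hw n le_rfl, hx]
      exact Nat.succ_ne_zero x
  | succ k ih =>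
    rcases hx : a n with _ | x
    · rw [bdSurv_zero_right, ENNReal.ofReal_zero, mul_zero]
      convert measure_empty (μ := μ)
      ext w
      simp only [Set.mem_ofPred_eq, Set.mem_empty_iff_false, iff_false, not_and]
      intro hw hne
      exact hne 0 (Nat.zero_le _) ((hw n le_rfl).trans hx)
    · set A : ℕ → Set (ℕ → ℕ) := fun b =>
        {w | (∀ i ≤ n + 1, w i = Function.update a (n + 1) b i) ∧ ∀ i ≤ k, w (n + 1 + i) ≠ 0}
        with hA
      have hcyl : ∀ (b : ℕ) (w : ℕ → ℕ), (∀ i ≤ n + 1, w i = Function.update a (n + 1) b i) ↔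
          (∀ i ≤ n, w i = a i) ∧ w (n + 1) = b := by
        intro b w
        constructor
        · intro hw
          refine ⟨fun i hi => ?_, by simpa using hw (n + 1) le_rfl⟩
          rw [hw i (by omega), Function.update_of_ne (by omega)]
        · rintro ⟨hw, hb⟩ i hi
          rcases Nat.lt_or_ge n i with h' | h'
          · obtain rfl : i = n + 1 := by omega
            simpa using hb
          · rw [Function.update_of_ne (by omega), hw i h']
      have hunion : {w : ℕ → ℕ | (∀ i ≤ n, w i = a i) ∧ ∀ i ≤ k + 1, w (n + i) ≠ 0}
          = ⋃ b, A b := by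
        ext w
        simp only [hA, Set.mem_ofPred_eq, Set.mem_iUnion, hcyl]
        constructor
        · rintro ⟨hw, hne⟩
          exact ⟨w (n + 1), ⟨hw, rfl⟩, fun i hi => by
            rw [add_assoc, add_comm 1]; exact hne (i + 1) (by omega)⟩
        · rintro ⟨b, ⟨hw, -⟩, hne⟩
          refine ⟨hw, fun i hi => ?_⟩
          rcases i with _ | i
          · rw [add_zero, hw n le_rfl, hx]
            exact Nat.succ_ne_zero x
          · rw [add_comm i 1, ← add_assoc]; exact hne i (by omega)
      have hdisj : Pairwise (Function.onFun Disjoint A) := by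
        intro b c hbc
        refine Set.disjoint_left.2 fun w hw hw' => hbc ?_
        rw [← ((hcyl b w).1 hw.1).2, ((hcyl c w).1 hw'.1).2]
      have hmeas : ∀ b, MeasurableSet (A b) := by
        intro b
        have : A b = (⋂ i ∈ Set.Iic (n + 1),
              (fun w : ℕ → ℕ => w i) ⁻¹' {Function.update a (n + 1) b i}) ∩
            ⋂ i ∈ Set.Iic k, (fun w : ℕ → ℕ => w (n + 1 + i)) ⁻¹' {0}ᶜ := by
          ext w; simp [hA]
        rw [this]
        exact (MeasurableSet.biInter (Set.to_countable _)
            fun i _ => measurable_pi_apply i MeasurableSet.of_discrete).inter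
          (MeasurableSet.biInter (Set.to_countable _)
            fun i _ => measurable_pi_apply _ MeasurableSet.of_discrete)
      rw [hunion, measure_iUnion hdisj hmeas, ← tsum_bdStep_mul_bdSurv h, ← ENNReal.tsum_mul_left]
      refine tsum_congr fun b => ?_
      rw [hA, ih (n + 1), Function.update_of_ne (by omega), Function.update_self,
        Finset.prod_range_succ, ← mul_assoc, ← mul_assoc, Function.update_self,
        Function.update_of_ne (by omega), hx, ENNReal.ofReal_mul]
      · congr 4
        refine Finset.prod_congr rfl fun i hi => ?_
        have := Finset.mem_range.1 hi
        rw [Function.update_of_ne (by omega), Function.update_of_ne (by omega)]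
      · exact mul_nonneg (hinit _) (Finset.prod_nonneg fun i _ => bdStep_nonneg h _ _)

lemma measure_avoidUpTo (h : IsBDParams p q) {μ : Measure (ℕ → ℕ)} {init : ℕ → ℝ}
    (hinit : ∀ x, 0 ≤ init x) (hμ : IsMarkovChainLaw μ init (bdStep p q)) (k : ℕ) :
    μ (avoidUpTo 0 k) = ∑' x, ENNReal.ofReal (init x) * ENNReal.ofReal (bdSurv p q k x) := by
  have hunion : avoidUpTo 0 k = ⋃ x, (avoidUpTo 0 k ∩ {w | w 0 = x}) := by
    rw [← Set.inter_iUnion, Set.inter_eq_left.2 fun w _ => Set.mem_iUnion.2 ⟨w 0, rfl⟩]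
  rw [hunion, measure_iUnion]
  · refine tsum_congr fun x => ?_
    have := measure_cylinder_inter_avoid h hinit hμ k 0 fun _ => x
    simp only [Finset.range_zero, Finset.prod_empty, mul_one] at this
    rw [← this]
    congr 1
    ext w
    simp [avoidUpTo, and_comm]
  · intro x y hxy
    exact Set.disjoint_left.2 fun w hw hw' => hxy (hw.2.symm.trans hw'.2)
  · exact fun x => (measurableSet_avoidUpTo 0 k).inter
      (measurableSet_eq_fun (measurable_pi_apply 0) measurable_const)

end PathLaw

section Flux

variable {p q : ℕ → ℝ}

lemma bdR_succ (p q : ℕ → ℝ) (n : ℕ) : bdR p q (n + 1) = bdR p q n * (p (n + 1) / q (n + 1)) := by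
  rw [bdR, bdR, Finset.prod_Icc_succ_top (by omega)]

namespace IsBDParams

lemma p_le_one (h : IsBDParams p q) (n : ℕ) : p (n + 1) ≤ 1 := by
  linarith [h.add_eq n, h.q_pos n]

lemma q_le_one (h : IsBDParams p q) (n : ℕ) : q (n + 1) ≤ 1 := by
  linarith [h.add_eq n, h.p_pos (n + 1)]

lemma R_pos (h : IsBDParams p q) (n : ℕ) : 0 < bdR p q n := by
  induction n with
  | zero => simp [bdR]
  | succ n ih => rw [bdR_succ]; exact mul_pos ih (div_pos (h.p_pos _) (h.q_pos _))

lemma rev_pos (h : IsBDParams p q) (n : ℕ) : 0 < bdRev p q n := div_pos (h.R_pos _) (h.p_pos _)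

lemma rev_mul_p (h : IsBDParams p q) (n : ℕ) : bdRev p q n * p (n + 1) = bdR p q (n + 1) :=
  div_mul_cancel₀ _ (h.p_pos _).ne'

lemma rev_mul_q (h : IsBDParams p q) (n : ℕ) : bdRev p q n * q (n + 1) = bdR p q n := by
  have := (h.p_pos (n + 1)).ne'
  have := (h.q_pos n).ne'
  rw [bdRev, bdR_succ]
  field_simp

lemma R_succ_le_rev (h : IsBDParams p q) (n : ℕ) : bdR p q (n + 1) ≤ bdRev p q n := by
  rw [← h.rev_mul_p]
  exact mul_le_of_le_one_right (h.rev_pos n).le (h.p_le_one n)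

lemma weight_succ (h : IsBDParams p q) (n : ℕ) : bdWeight p q (n + 1) = p 0 * bdRev p q n := by
  rw [bdRev, mul_div_assoc', eq_div_iff (h.p_pos _).ne']
  induction n with
  | zero => simp [bdWeight, bdR]; ring
  | succ n ih =>
    rw [bdR_succ, ← mul_assoc, ← ih, bdWeight, bdWeight, Finset.prod_range_succ]
    ring

lemma summable_rev_add (hs : Summable (bdRev p q)) (j : ℕ) :
    Summable fun i => bdRev p q (j + i) := by
  simpa only [add_comm j] using (summable_nat_add_iff j).2 hs

lemma summable_rev_mul_surv (h : IsBDParams p q) (hs : Summable (bdRev p q)) (k j : ℕ) :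
    Summable fun i => bdRev p q (j + i) * bdSurv p q k (j + i + 1) :=
  (summable_rev_add hs j).of_nonneg_of_le
    (fun _ => mul_nonneg (h.rev_pos _).le (h.surv_nonneg _ _))
    fun _ => mul_le_of_le_one_right (h.rev_pos _).le (h.surv_le_one _ _)

lemma tail_nonneg (h : IsBDParams p q) (k j : ℕ) : 0 ≤ bdTail p q k j :=
  tsum_nonneg fun _ => mul_nonneg (h.rev_pos _).le (h.surv_nonneg _ _)

lemma tendsto_R (h : IsBDParams p q) (hs : Summable (bdRev p q)) :
    Tendsto (bdR p q) atTop (𝓝 0) := by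
  rw [← tendsto_add_atTop_iff_nat 1]
  exact squeeze_zero (fun n => (h.R_pos _).le) h.R_succ_le_rev hs.tendsto_atTop_zero

/-- The mass lost in one step from the states `> j` is the flux through the edge `{j, j + 1}`. -/
lemma tail_sub_tail_succ (h : IsBDParams p q) (hs : Summable (bdRev p q)) (k j : ℕ) :
    bdTail p q k j - bdTail p q (k + 1) j
      = bdR p q j * (bdSurv p q k (j + 1) - bdSurv p q k j) := by
  have h0 := h.summable_rev_mul_surv hs k j
  have h1 := h.summable_rev_mul_surv hs (k + 1) j
  rw [bdTail, bdTail, ← h0.tsum_sub h1]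
  refine tsum_eq_of_telescope
    (g := fun i => bdR p q (j + i) * (bdSurv p q k (j + i + 1) - bdSurv p q k (j + i)))
    (h0.sub h1) (fun n => ?_) ?_
  · rw [bdSurv_succ_succ, ← add_assoc j n 1, ← h.rev_mul_q (j + n), ← h.rev_mul_p (j + n)]
    linear_combination -bdRev p q (j + n) * bdSurv p q k (j + n + 1) * h.add_eq (j + n)
  · have hR : Tendsto (fun i => bdR p q (j + i)) atTop (𝓝 0) := by
      simpa only [add_comm j] using (tendsto_add_atTop_iff_nat j).2 (h.tendsto_R hs)
    refine squeeze_zero_norm (fun i => ?_) hR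
    rw [norm_mul, Real.norm_of_nonneg (h.R_pos _).le]
    refine mul_le_of_le_one_right (h.R_pos _).le ?_
    rw [Real.norm_eq_abs, abs_le]
    constructor <;>
      linarith [h.surv_nonneg k (j + i), h.surv_nonneg k (j + i + 1), h.surv_le_one k (j + i),
        h.surv_le_one k (j + i + 1)]

lemma tendsto_tail (h : IsBDParams p q) (hs : Summable (bdRev p q)) (j : ℕ) :
    Tendsto (fun k => bdTail p q k j) atTop (𝓝 0) := by
  have := tendsto_tsum_of_dominated_convergence (𝓕 := atTop) (g := fun _ => (0 : ℝ))
    (f := fun k i => bdRev p q (j + i) * bdSurv p q k (j + i + 1)) (summable_rev_add hs j)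
    (fun i => by simpa using (h.tendsto_surv (j + i + 1)).const_mul (bdRev p q (j + i)))
    (Eventually.of_forall fun k i => by
      rw [Real.norm_of_nonneg (mul_nonneg (h.rev_pos _).le (h.surv_nonneg _ _))]
      exact mul_le_of_le_one_right (h.rev_pos _).le (h.surv_le_one _ _))
  simpa [bdTail] using this

/-- Mean hitting time of `0` from `x`. -/
lemma hasSum_surv (h : IsBDParams p q) (hs : Summable (bdRev p q)) (x : ℕ) :
    HasSum (fun k => bdSurv p q k x) (∑ i ∈ Finset.range x, bdTail p q 0 i / bdR p q i) := by
  rw [hasSum_iff_tendsto_nat_of_nonneg fun k => h.surv_nonneg k x]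
  have hstep : ∀ K j, ∑ k ∈ Finset.range K, bdSurv p q k (j + 1)
      - ∑ k ∈ Finset.range K, bdSurv p q k j
        = (bdTail p q 0 j - bdTail p q K j) / bdR p q j := fun K j => by
    rw [eq_div_iff (h.R_pos j).ne', ← Finset.sum_sub_distrib, Finset.sum_mul,
      ← Finset.sum_range_sub' (fun k => bdTail p q k j)]
    exact Finset.sum_congr rfl fun k _ => by rw [h.tail_sub_tail_succ hs, mul_comm]
  have hsum : ∀ K, ∑ k ∈ Finset.range K, bdSurv p q k x
      = ∑ j ∈ Finset.range x, (bdTail p q 0 j - bdTail p q K j) / bdR p q j := fun K => by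
    simp_rw [← hstep, Finset.sum_range_sub (fun j => ∑ k ∈ Finset.range K, bdSurv p q k j)]
    simp
  simp_rw [hsum]
  refine tendsto_finsetSum _ fun j _ => ?_
  simpa using ((tendsto_const_nhds (x := bdTail p q 0 j)).sub (h.tendsto_tail hs j)).div_const
    (bdR p q j)

/-- Survival from `1` past time `k` and equilibrium survival are dual to each other. -/
lemma hasSum_surv_one (h : IsBDParams p q) (hs : Summable (bdRev p q)) (k : ℕ) :
    HasSum (fun n => bdSurv p q (k + n) 1) (bdTail p q k 0) := by
  rw [hasSum_iff_tendsto_nat_of_nonneg fun n => h.surv_nonneg _ _]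
  have hsum : ∀ N, ∑ n ∈ Finset.range N, bdSurv p q (k + n) 1
      = bdTail p q k 0 - bdTail p q (k + N) 0 := fun N => by
    have htel := Finset.sum_range_sub' (fun n => bdTail p q (k + n) 0) N
    rw [add_zero] at htel
    rw [← htel]
    refine Finset.sum_congr rfl fun n _ => ?_
    rw [← add_assoc, h.tail_sub_tail_succ hs]
    simp [bdR]
  simp_rw [hsum]
  have : Tendsto (fun N => bdTail p q (k + N) 0) atTop (𝓝 0) := by
    simpa only [add_comm k] using (tendsto_add_atTop_iff_nat k).2 (h.tendsto_tail hs 0)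
  simpa using tendsto_const_nhds.sub this

end IsBDParams

end Flux

section Equivalences

variable {p q : ℕ → ℝ}

/-- Unnormalized mean hitting time of `0` from the reversible measure on the positive states. -/
noncomputable def bdMeanHit (p q : ℕ → ℝ) : ℝ≥0∞ :=
  ∑' y, ENNReal.ofReal (bdRev p q y) * ∑' k, ENNReal.ofReal (bdSurv p q k (y + 1))

namespace IsBDParams

lemma meanHit_eq_tsum_tail (h : IsBDParams p q) (hs : Summable (bdRev p q)) :
    bdMeanHit p q = ∑' i, ENNReal.ofReal (bdTail p q 0 i ^ 2 / bdR p q i) := by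
  have hu : ∀ y, ∑' k, ENNReal.ofReal (bdSurv p q k (y + 1))
      = ∑ i ∈ Finset.range (y + 1), ENNReal.ofReal (bdTail p q 0 i / bdR p q i) := fun y => by
    have hsum := h.hasSum_surv hs (y + 1)
    rw [← ENNReal.ofReal_tsum_of_nonneg (fun k => h.surv_nonneg _ _) hsum.summable, hsum.tsum_eq,
      ENNReal.ofReal_sum_of_nonneg fun i _ => div_nonneg (h.tail_nonneg _ _) (h.R_pos _).le]
  rw [bdMeanHit]
  simp_rw [hu]
  rw [ENNReal.tsum_mul_sum_range_succ]
  refine tsum_congr fun i => ?_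
  rw [← ENNReal.ofReal_tsum_of_nonneg (fun k => (h.rev_pos _).le) (summable_rev_add hs i),
    ← ENNReal.ofReal_mul (div_nonneg (h.tail_nonneg _ _) (h.R_pos _).le)]
  congr 1
  simp only [bdTail, bdSurv_zero_succ, mul_one]
  ring

lemma meanHit_eq_tsum_surv_one (h : IsBDParams p q) (hs : Summable (bdRev p q)) :
    bdMeanHit p q = ∑' k : ℕ, (k + 1 : ℝ≥0∞) * ENNReal.ofReal (bdSurv p q k 1) := by
  rw [← ENNReal.tsum_tsum_add fun k => ENNReal.ofReal (bdSurv p q k 1), bdMeanHit]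
  simp_rw [← ENNReal.tsum_mul_left]
  rw [ENNReal.tsum_comm]
  refine tsum_congr fun k => ?_
  have hsum := h.hasSum_surv_one hs k
  rw [← ENNReal.ofReal_tsum_of_nonneg (fun n => h.surv_nonneg _ _) hsum.summable, hsum.tsum_eq,
    bdTail, ENNReal.ofReal_tsum_of_nonneg
      (fun i => mul_nonneg (h.rev_pos _).le (h.surv_nonneg _ _)) (h.summable_rev_mul_surv hs k 0)]
  exact tsum_congr fun y => by rw [zero_add, ENNReal.ofReal_mul (h.rev_pos _).le]

lemma summable_iff_meanHit_lt_top (h : IsBDParams p q) (hs : Summable (bdRev p q)) {c : ℝ}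
    (hc : 0 < c) (hcp : ∀ n, c ≤ p n) :
    Summable (fun n : ℕ => bdS p q (n + 1) ^ 2 / bdR p q (n + 1)) ↔ bdMeanHit p q < ⊤ := by
  have hcmp : bdMeanHit p q < ⊤ ↔ Summable fun i => bdTail p q 0 i ^ 2 / bdR p q i := by
    have hnn : ∀ i, 0 ≤ bdTail p q 0 i ^ 2 / bdR p q i := fun i =>
      div_nonneg (sq_nonneg _) (h.R_pos i).le
    rw [h.meanHit_eq_tsum_tail hs, lt_top_iff_ne_top]
    constructor
    · intro hne
      simpa [ENNReal.toReal_ofReal (hnn _)] using ENNReal.summable_toReal hne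
    · intro hsum
      rw [← ENNReal.ofReal_tsum_of_nonneg hnn hsum]
      exact ENNReal.ofReal_ne_top
  rw [hcmp]
  have hR : ∀ n, Summable fun i => bdR p q (n + 1 + i) := fun n =>
    (summable_rev_add hs n).of_nonneg_of_le (fun i => (h.R_pos _).le) fun i => by
      rw [add_right_comm]; exact h.R_succ_le_rev _
  have htail : ∀ n, bdTail p q 0 n = ∑' i, bdRev p q (n + i) := fun n => by simp [bdTail]
  have hS0 : ∀ n, 0 ≤ bdS p q n := fun n => tsum_nonneg fun i => (h.R_pos _).le
  have hlow : ∀ n, bdS p q (n + 1) ≤ bdTail p q 0 n := fun n => by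
    rw [htail]
    refine (hR n).tsum_le_tsum (fun i => ?_) (summable_rev_add hs n)
    rw [add_right_comm]; exact h.R_succ_le_rev _
  have hupp : ∀ n, c * bdTail p q 0 n ≤ bdS p q (n + 1) := fun n => by
    rw [htail, ← tsum_mul_left]
    refine ((summable_rev_add hs n).mul_left c).tsum_le_tsum (fun i => ?_) (hR n)
    rw [add_right_comm, ← h.rev_mul_p, mul_comm]
    exact mul_le_mul_of_nonneg_left (hcp _) (h.rev_pos _).le
  have hRle : ∀ n, bdR p q (n + 1) ≤ bdR p q n := fun n => by
    rw [← h.rev_mul_p, ← h.rev_mul_q]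
    exact mul_le_mul_of_nonneg_left (h.le n) (h.rev_pos _).le
  have hRge : ∀ n, c * bdR p q n ≤ bdR p q (n + 1) := fun n => by
    rw [← h.rev_mul_p, ← h.rev_mul_q]
    have := mul_le_mul (hcp (n + 1)) (h.q_le_one n) (h.q_pos n).le (h.p_pos _).le
    nlinarith [h.rev_pos n]
  constructor
  · intro hsum
    refine (hsum.mul_left (1 / c ^ 2)).of_nonneg_of_le
      (fun n => div_nonneg (sq_nonneg _) (h.R_pos n).le) fun n => ?_
    calc bdTail p q 0 n ^ 2 / bdR p q n
        = 1 / c ^ 2 * ((c * bdTail p q 0 n) ^ 2 / bdR p q n) := by field_simp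
      _ ≤ 1 / c ^ 2 * (bdS p q (n + 1) ^ 2 / bdR p q (n + 1)) := by
          have := mul_nonneg hc.le (h.tail_nonneg 0 n)
          have := h.R_pos (n + 1)
          gcongr
          exacts [hupp n, hRle n]
  · intro hsum
    refine (hsum.mul_left (1 / c)).of_nonneg_of_le
      (fun n => div_nonneg (sq_nonneg _) (h.R_pos _).le) fun n => ?_
    calc bdS p q (n + 1) ^ 2 / bdR p q (n + 1)
        ≤ bdTail p q 0 n ^ 2 / (c * bdR p q n) := by
          have := hS0 (n + 1)
          have := mul_pos hc (h.R_pos n)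
          gcongr
          exacts [hlow n, hRge n]
      _ = 1 / c * (bdTail p q 0 n ^ 2 / bdR p q n) := by
          have := (h.R_pos n).ne'
          field_simp

lemma lintegral_hitTimeE_equilibrium (h : IsBDParams p q) {ν : ℕ → ℝ} {W : ℝ} (hW : 0 < W)
    (hν : ∀ n, ν n = bdWeight p q n / W) {μ : Measure (ℕ → ℕ)}
    (hμ : IsMarkovChainLaw μ ν (bdStep p q)) :
    ∫⁻ w, hitTimeE 0 w ∂μ = ENNReal.ofReal (p 0 / W) * bdMeanHit p q := by
  have hνsucc : ∀ y, ν (y + 1) = p 0 / W * bdRev p q y := fun y => by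
    rw [hν, h.weight_succ]; ring
  have hC : 0 ≤ p 0 / W := div_nonneg (h.p_pos 0).le hW.le
  have hνnn : ∀ x, 0 ≤ ν x := by
    rintro (_ | y)
    · rw [hν]; simp [bdWeight, hW.le]
    · rw [hνsucc]; exact mul_nonneg hC (h.rev_pos y).le
  rw [lintegral_hitTimeE]
  simp_rw [measure_avoidUpTo h hνnn hμ]
  rw [ENNReal.tsum_comm, tsum_eq_zero_add' ENNReal.summable, bdMeanHit, ← ENNReal.tsum_mul_left]
  simp only [bdSurv_zero_right, ENNReal.ofReal_zero, mul_zero, tsum_zero, zero_add]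
  refine tsum_congr fun y => ?_
  rw [ENNReal.tsum_mul_left, hνsucc, ENNReal.ofReal_mul hC, mul_assoc]

lemma lintegral_hitTimeE_sq_lt_top_iff (h : IsBDParams p q) (hs : Summable (bdRev p q))
    {μ : Measure (ℕ → ℕ)}
    (hμ : IsMarkovChainLaw μ (fun m => if m = 1 then 1 else 0) (bdStep p q)) :
    ∫⁻ w, hitTimeE 0 w ^ 2 ∂μ < ⊤ ↔ bdMeanHit p q < ⊤ := by
  have hone : ∀ k, μ (avoidUpTo 0 k) = ENNReal.ofReal (bdSurv p q k 1) := fun k => by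
    rw [measure_avoidUpTo h (fun x => by split_ifs <;> simp) hμ, tsum_eq_single 1]
    · simp
    · intro x hx; simp [hx]
  rw [lintegral_hitTimeE_sq, h.meanHit_eq_tsum_surv_one hs]
  simp_rw [hone]
  constructor
  · refine fun hlt => lt_of_le_of_lt (ENNReal.tsum_le_tsum fun k => ?_) hlt
    gcongr
    exact le_mul_of_one_le_left' one_le_two
  · intro hlt
    refine lt_of_le_of_lt ?_ (ENNReal.mul_lt_top (ENNReal.ofNat_lt_top (n := 2)) hlt)
    rw [← ENNReal.tsum_mul_left]
    refine ENNReal.tsum_le_tsum fun k => ?_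
    rw [← mul_assoc, mul_add, mul_one]
    gcongr
    exact one_le_two

end IsBDParams

end Equivalences

/-- **Equivalence of the 'strong ergodicity' conditions** (Appendix A):
for the embedded discrete birth-and-death chain, the following are equivalent:
(i) `∑_{n≥1} S_n²/R_n < ∞`; (ii) the mean hitting time of `0` from the equilibrium
distribution `ν` is finite; (iii) the second moment of the hitting time of `0`
started from state `1` is finite. -/
theorem strong_ergodicity_tfae (p q : ℕ → ℝ)
    (hp : ∀ n, p n ∈ Set.Ioo (0 : ℝ) 1)
    (hq : ∀ n, 1 ≤ n → q n ∈ Set.Ioo (0 : ℝ) 1)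
    (hpq : ∀ n, 1 ≤ n → p n + q n = 1)
    (hple : ∀ n, 1 ≤ n → p n ≤ q n)
    (hinf : ∃ c : ℝ, 0 < c ∧ ∀ n, c ≤ p n)
    (hsum : Summable (bdWeight p q))
    (ν : ℕ → ℝ) (hν : ∀ n, ν n = bdWeight p q n / ∑' m : ℕ, bdWeight p q m)
    (μν μ1 : Measure (ℕ → ℕ)) [IsProbabilityMeasure μν] [IsProbabilityMeasure μ1]
    (hμν : IsMarkovChainLaw μν ν (bdStep p q))
    (hμ1 : IsMarkovChainLaw μ1 (fun m => if m = 1 then 1 else 0) (bdStep p q)) :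
    List.TFAE
      [Summable (fun n : ℕ => (bdS p q (n + 1)) ^ 2 / bdR p q (n + 1)),
       ∫⁻ w, hitTimeE 0 w ∂μν < ⊤,
       ∫⁻ w, (hitTimeE 0 w) ^ 2 ∂μ1 < ⊤] := by
  have h : IsBDParams p q :=
    { p_pos := fun n => (hp n).1
      q_pos := fun n => (hq (n + 1) (by omega)).1
      add_eq := fun n => hpq (n + 1) (by omega)
      le := fun n => hple (n + 1) (by omega) }
  have hs : Summable (bdRev p q) := by
    have := ((summable_nat_add_iff 1).2 hsum).mul_left (p 0)⁻¹
    simpa [h.weight_succ, (h.p_pos 0).ne'] using this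
  have hW : 0 < ∑' m, bdWeight p q m :=
    hsum.tsum_pos
      (fun n => Finset.prod_nonneg fun i _ => div_nonneg (h.p_pos i).le (h.q_pos i).le) 0
      (by simp [bdWeight])
  obtain ⟨c, hc, hcp⟩ := hinf
  have h_i := h.summable_iff_meanHit_lt_top hs hc hcp
  have h_iii := h.lintegral_hitTimeE_sq_lt_top_iff hs hμ1
  have h_ii : ∫⁻ w, hitTimeE 0 w ∂μν < ⊤ ↔ bdMeanHit p q < ⊤ := by
    rw [h.lintegral_hitTimeE_equilibrium hW hν hμν,
      ENNReal.mul_lt_top_iff]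
    have : ENNReal.ofReal (p 0 / ∑' m, bdWeight p q m) ≠ 0 := by
      simpa using div_pos (h.p_pos 0) hW
    constructor
    · rintro (⟨-, hlt⟩ | h0 | h0)
      exacts [hlt, absurd h0 this, h0 ▸ ENNReal.zero_lt_top]
    · exact fun hlt => Or.inl ⟨ENNReal.ofReal_lt_top, hlt⟩
  tfae_have 1 ↔ 2 := h_i.trans h_ii.symm
  tfae_have 2 ↔ 3 := h_ii.trans h_iii.symm
  tfae_finish
end

section
/- Let ν be a probability measure on ℕ with ν({n}) > 0 for every n ∈ ℕ, let d ≥ 1, and let ν̂ = ⊗_{x ∈ ℤ^d} ν be the product measure on ℕ^{ℤ^d} with the product σ-algebra. Let μ be a probability measure on ℕ^{ℤ^d} with the following property: for every ε > 0 there exist a finite set Q ⊆ ℤ^d and a probability measure m on ℕ^Q such that |μ(A) − (m ⊗ ν̌_Q)(A)| ≤ ε for every measurable A ⊆ ℕ^{ℤ^d}, where ν̌_Q = ⊗_{x ∈ ℤ^d∖Q} ν and ℕ^{ℤ^d} is identified with ℕ^Q × ℕ^{ℤ^d∖Q}. Then μ is absolutely continuous with respect to ν̂. -/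
open MeasureTheory
open scoped BigOperators

/-- `μ` is the product over `ι` of copies of `ν`: every cylinder event has the product
probability. -/
def IsIIDProduct {ι : Type*} (ν : Measure ℕ) (μ : Measure (ι → ℕ)) : Prop :=
  ∀ (F : Finset ι) (a : ι → ℕ), μ {x | ∀ i ∈ F, x i = a i} = ∏ i ∈ F, ν {a i}

/-- Glue a configuration on a finite set `Q ⊆ ℤ^d` with a configuration on its
complement. -/
def glueConfig {d : ℕ} (Q : Finset (Fin d → ℤ))
    (η : {x : Fin d → ℤ // x ∈ Q} → ℕ) (ζ : {x : Fin d → ℤ // x ∉ Q} → ℕ) :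
    (Fin d → ℤ) → ℕ :=
  fun x => if h : x ∈ Q then η ⟨x, h⟩ else ζ ⟨x, h⟩

/-- The law of an i.i.d. product is determined by its cylinder probabilities. -/
theorem IsIIDProduct.eq_infinitePi {ι : Type*} {ν : Measure ℕ} [IsProbabilityMeasure ν]
    {μ : Measure (ι → ℕ)} (h : IsIIDProduct ν μ) :
    μ = Measure.infinitePi (fun _ : ι => ν) := by
  classical
  have hlim : IsProjectiveLimit μ
      (fun I : Finset ι => Measure.pi (fun _ : I => ν)) := by
    intro I
    refine Measure.ext_of_singleton fun a => ?_
    rw [Measure.map_apply (by fun_prop) (measurableSet_singleton a), Measure.pi_singleton]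
    have hset : I.restrict (π := fun _ : ι => ℕ) ⁻¹' {a} =
        {x : ι → ℕ | ∀ i ∈ I, x i = if hi : i ∈ I then a ⟨i, hi⟩ else 0} := by
      ext x
      simp only [Set.mem_preimage, Set.mem_singleton_iff, Set.mem_ofPred_eq, funext_iff,
        Subtype.forall, Finset.restrict]
      refine forall₂_congr fun i hi => ?_
      simp [hi]
    rw [hset, h, ← Finset.prod_coe_sort]
    simp
  exact hlim.unique (Measure.isProjectiveLimit_infinitePi _)

theorem isIIDProduct_infinitePi {ι : Type*} (ν : Measure ℕ) [IsProbabilityMeasure ν] :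
    IsIIDProduct ν (Measure.infinitePi (fun _ : ι => ν)) := by
  intro F a
  rw [← Measure.infinitePi_pi (μ := fun _ : ι => ν) fun i _ => measurableSet_singleton (a i)]
  congr 1

/-- An i.i.d. product over a finite index set charges every point, so it dominates every
measure. -/
theorem IsIIDProduct.absolutelyContinuous {ι : Type*} [Fintype ι] {ν : Measure ℕ}
    (hν : ∀ n, ν {n} ≠ 0) {μ : Measure (ι → ℕ)} (h : IsIIDProduct ν μ)
    (m : Measure (ι → ℕ)) : m ≪ μ := by
  have hpoint : ∀ a : ι → ℕ, μ {a} ≠ 0 := by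
    intro a
    have hset : ({a} : Set (ι → ℕ)) = {x | ∀ i ∈ Finset.univ, x i = a i} := by
      ext x
      simp [funext_iff]
    rw [hset, h]
    exact Finset.prod_ne_zero_iff.mpr fun i _ => hν _
  intro s hs
  have hempty : s = ∅ := by
    refine Set.eq_empty_of_forall_notMem fun a ha => hpoint a ?_
    exact measure_mono_null (Set.singleton_subset_iff.mpr ha) hs
  simp [hempty]

theorem measurable_glueConfig {d : ℕ} (Q : Finset (Fin d → ℤ)) :
    Measurable (fun p : ({x : Fin d → ℤ // x ∈ Q} → ℕ) × ({x : Fin d → ℤ // x ∉ Q} → ℕ) =>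
      glueConfig Q p.1 p.2) := by
  refine measurable_pi_lambda _ fun x => ?_
  by_cases hx : x ∈ Q <;> simp only [glueConfig, hx, dite_true, dite_false] <;> fun_prop

/-- Gluing independent i.i.d. products on a box and on its complement gives an i.i.d. product. -/
theorem IsIIDProduct.map_glueConfig {d : ℕ} {Q : Finset (Fin d → ℤ)} {ν : Measure ℕ}
    {ρ : Measure ({x : Fin d → ℤ // x ∈ Q} → ℕ)} {κ : Measure ({x : Fin d → ℤ // x ∉ Q} → ℕ)}
    [SFinite κ] (hρ : IsIIDProduct ν ρ) (hκ : IsIIDProduct ν κ) :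
    IsIIDProduct ν (Measure.map
      (fun p : ({x : Fin d → ℤ // x ∈ Q} → ℕ) × ({x : Fin d → ℤ // x ∉ Q} → ℕ) =>
        glueConfig Q p.1 p.2) (ρ.prod κ)) := by
  intro F a
  have hmeas : MeasurableSet {x : (Fin d → ℤ) → ℕ | ∀ i ∈ F, x i = a i} := by
    measurability
  have hset : (fun p : ({x : Fin d → ℤ // x ∈ Q} → ℕ) × ({x : Fin d → ℤ // x ∉ Q} → ℕ) =>
        glueConfig Q p.1 p.2) ⁻¹' {x | ∀ i ∈ F, x i = a i} =
      {η | ∀ i ∈ F.subtype (· ∈ Q), η i = a i} ×ˢ {ζ | ∀ i ∈ F.subtype (· ∉ Q), ζ i = a i} := by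
    ext ⟨η, ζ⟩
    simp only [Set.mem_preimage, Set.mem_ofPred_eq, Set.mem_prod, Finset.mem_subtype,
      Subtype.forall, glueConfig]
    constructor
    · intro h
      exact ⟨fun i hi hF => by simpa [hi] using h i hF,
        fun i hi hF => by simpa [hi] using h i hF⟩
    · rintro ⟨h₁, h₂⟩ i hF
      by_cases hi : i ∈ Q
      · simpa [hi] using h₁ i hi hF
      · simpa [hi] using h₂ i hi hF
  rw [Measure.map_apply (measurable_glueConfig Q) hmeas, hset, Measure.prod_prod,
    hρ _ fun i => a i, hκ _ fun i => a i, Finset.prod_subtype_eq_prod_filter (fun i => ν {a i}),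
    Finset.prod_subtype_eq_prod_filter (fun i => ν {a i}), Finset.prod_filter_mul_prod_filter_not]

/-- **Approximability by finite-box perturbations of the product of equilibria forces
absolute continuity**: if `ν({n}) > 0` for all `n`, `ν̂ = ⊗_{x ∈ ℤ^d} ν`, and `μ` is a
probability measure such that for every `ε > 0` there are a finite `Q ⊆ ℤ^d` and a
probability `m` on `ℕ^Q` with `|μ(A) − (m ⊗ ν̌_Q)(A)| ≤ ε` for all measurable `A`,
then `μ ≪ ν̂`. -/
theorem absolutelyContinuous_of_finite_box_approx {d : ℕ} (hd : 1 ≤ d)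
    (ν : Measure ℕ) [IsProbabilityMeasure ν] (hν : ∀ n : ℕ, ν {n} ≠ 0)
    (νhat : Measure ((Fin d → ℤ) → ℕ)) [IsProbabilityMeasure νhat]
    (hνhat : IsIIDProduct ν νhat)
    (μ : Measure ((Fin d → ℤ) → ℕ)) [IsProbabilityMeasure μ]
    (happrox : ∀ ε : ℝ, 0 < ε → ∃ (Q : Finset (Fin d → ℤ))
        (m : Measure ({x : Fin d → ℤ // x ∈ Q} → ℕ))
        (νchk : Measure ({x : Fin d → ℤ // x ∉ Q} → ℕ)),
        IsProbabilityMeasure m ∧ IsProbabilityMeasure νchk ∧ IsIIDProduct ν νchk ∧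
        ∀ A : Set ((Fin d → ℤ) → ℕ), MeasurableSet A →
          |(μ A).toReal -
            ((Measure.map
                (fun p : ({x : Fin d → ℤ // x ∈ Q} → ℕ) × ({x : Fin d → ℤ // x ∉ Q} → ℕ)
                  => glueConfig Q p.1 p.2) (m.prod νchk)) A).toReal| ≤ ε) :
    μ ≪ νhat := by
  refine Measure.AbsolutelyContinuous.mk fun A hA hzero => ?_
  have hle : ∀ ε : ℝ, 0 < ε → (μ A).toReal ≤ ε := by
    intro ε hε
    obtain ⟨Q, m, νchk, hm, hchk, hiid, h⟩ := happrox ε hε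
    have hνhat_eq := hνhat.eq_infinitePi.trans
      ((isIIDProduct_infinitePi ν).map_glueConfig hiid).eq_infinitePi.symm
    have hac := (((isIIDProduct_infinitePi ν).absolutelyContinuous hν m).prod
      (Measure.AbsolutelyContinuous.refl νchk)).map (measurable_glueConfig Q)
    rw [← hνhat_eq] at hac
    have hA' := h A hA
    rw [hac hzero, ENNReal.toReal_zero, sub_zero] at hA'
    exact (le_abs_self _).trans hA'
  have hμ : (μ A).toReal = 0 :=
    le_antisymm (le_of_forall_gt_imp_ge_of_dense hle) ENNReal.toReal_nonneg
  exact (ENNReal.toReal_eq_zero_iff _).mp hμ |>.resolve_right (measure_ne_top μ A)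
end
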